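/- arXiv:1907.11742 — 2 statements merged into one kernel-verified Lean document; each statement's English description precedes it below -/
import Mathlib

section
/- Suppose the gradients ∇f₁(x̄), …, ∇f_k(x̄) are affinely independent and there exists λ̄ ∈ ℝᵏ with Σᵢ λ̄_i = 1 and Σᵢ λ̄_i ∇f_i(x̄) = 0. Then there exist γ₀ > 0 and C > 0 such that for every γ ∈ (0, γ₀] and all points x₁, …, x_k in the closed ball B_γ(x̄), the problem of minimizing |Σᵢ λ_i ∇f_i(x_i)| over {λ ∈ ℝᵏ : Σᵢ λ_i = 1} has a unique minimizer λ, and this minimizer satisfies |λ − λ̄| ≤ Cγ. -/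
open scoped RealInnerProductSpace in
/-- If `G` is bounded below on a finite-dimensional subspace `V`, then some point of `a + V` has
image orthogonal to `G V`, at distance from `a` controlled by `‖G a‖`. -/
theorem exists_sub_mem_forall_inner_map_eq_zero
    {E F : Type*} [NormedAddCommGroup E] [InnerProductSpace ℝ E]
    [NormedAddCommGroup F] [InnerProductSpace ℝ F]
    (G : E →ₗ[ℝ] F) (V : Submodule ℝ E) [FiniteDimensional ℝ V] {K : ℝ} (hK0 : 0 ≤ K)
    (hK : ∀ v ∈ V, ‖v‖ ≤ K * ‖G v‖) (a : E) :
    ∃ b : E, b - a ∈ V ∧ (∀ w ∈ V, ⟪G b, G w⟫ = 0) ∧ ‖b - a‖ ≤ K * ‖G a‖ := by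
  obtain ⟨v, hv, hGv⟩ := Submodule.mem_map.1 ((V.map G).starProjection_apply_mem (G a))
  refine ⟨a - v, by simpa using hv, fun w hw => ?_, ?_⟩
  · rw [map_sub, hGv]
    exact (V.map G).starProjection_inner_eq_zero _ _ (Submodule.mem_map_of_mem hw)
  · have h := hK v hv
    rw [hGv] at h
    have hle := (V.map G).norm_starProjection_apply_le (G a)
    calc ‖a - v - a‖ = ‖v‖ := by rw [sub_sub_cancel_left, norm_neg]
      _ ≤ K * ‖G a‖ := h.trans (by gcongr)

/-- The linear map `λ ↦ ∑ i, λ i • g i` on Euclidean space. -/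
noncomputable def euclideanCombination {k : ℕ} {F : Type*} [AddCommGroup F] [Module ℝ F]
    (g : Fin k → F) : EuclideanSpace ℝ (Fin k) →ₗ[ℝ] F :=
  Fintype.linearCombination ℝ g ∘ₗ (WithLp.linearEquiv 2 ℝ (Fin k → ℝ)).toLinearMap

theorem euclideanCombination_apply {k : ℕ} {F : Type*} [AddCommGroup F] [Module ℝ F]
    (g : Fin k → F) (v : EuclideanSpace ℝ (Fin k)) :
    euclideanCombination g v = ∑ i, v i • g i := by
  simp [euclideanCombination, Fintype.linearCombination_apply]

theorem norm_euclideanCombination_le {k : ℕ} {F : Type*} [NormedAddCommGroup F] [NormedSpace ℝ F]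
    (g : Fin k → F) {M : ℝ} (hg : ∀ i, ‖g i‖ ≤ M) (v : EuclideanSpace ℝ (Fin k)) :
    ‖euclideanCombination g v‖ ≤ k * M * ‖v‖ := by
  rw [euclideanCombination_apply]
  calc ‖∑ i, v i • g i‖ ≤ ∑ _i : Fin k, ‖v‖ * M := by
        refine norm_sum_le_of_le _ fun i _ => ?_
        rw [norm_smul]
        gcongr
        · exact PiLp.norm_apply_le v i
        · exact hg i
    _ = k * M * ‖v‖ := by simp; ring

/-- Affinely independent vectors bound the coefficients of their combinations of weight zero. -/
theorem exists_norm_le_mul_norm_euclideanCombination {k : ℕ} {F : Type*} [NormedAddCommGroup F]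
    [NormedSpace ℝ F] (g : Fin k → F)
    (hg : LinearIndependent ℝ (fun i => ((g i, 1) : F × ℝ))) :
    ∃ K > (0 : ℝ), ∀ v : EuclideanSpace ℝ (Fin k), ∑ i, v i = 0 →
      ‖v‖ ≤ K * ‖euclideanCombination g v‖ := by
  have hker : LinearMap.ker (euclideanCombination fun i => ((g i, 1) : F × ℝ)) = ⊥ := by
    rw [LinearMap.ker_eq_bot']
    intro v hv
    rw [euclideanCombination_apply] at hv
    ext i
    exact Fintype.linearIndependent_iff.1 hg v hv i
  obtain ⟨K, hK0, hK⟩ := LinearMap.exists_antilipschitzWith _ hker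
  refine ⟨K, hK0, fun v hv => ?_⟩
  have h := hK.le_mul_dist v 0
  rw [map_zero, dist_zero_right, dist_zero_right] at h
  have hpair : euclideanCombination (fun i => ((g i, 1) : F × ℝ)) v =
      (euclideanCombination g v, 0) := by
    simp only [euclideanCombination_apply]
    ext <;> simp [Prod.fst_sum, Prod.snd_sum, hv]
  rw [hpair] at h
  simpa [Prod.norm_def] using h

/-- The gradient of a `C²` function is differentiable. -/
theorem ContDiff.differentiable_gradient {F : Type*} [NormedAddCommGroup F]
    [InnerProductSpace ℝ F] [CompleteSpace F] {f : F → ℝ} (hf : ContDiff ℝ 2 f) :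
    Differentiable ℝ (gradient f) := by
  have h : Differentiable ℝ (fderiv ℝ f) :=
    (hf.fderiv_right (m := 1) (by norm_num)).differentiable (by norm_num)
  exact (InnerProductSpace.toDual ℝ F).symm.differentiable.comp h

/-- Finitely many functions differentiable at `a` satisfy a common Lipschitz estimate at `a`. -/
theorem exists_forall_norm_sub_le_of_differentiableAt {ι E F : Type*} [Fintype ι]
    [NormedAddCommGroup E] [NormedSpace ℝ E] [NormedAddCommGroup F] [NormedSpace ℝ F]
    {f : ι → E → F} {a : E} (hf : ∀ i, DifferentiableAt ℝ (f i) a) :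
    ∃ δ > (0 : ℝ), ∃ L > (0 : ℝ), ∀ x, ‖x - a‖ < δ → ∀ i, ‖f i x - f i a‖ ≤ L * ‖x - a‖ := by
  have hO : (fun x i => f i x - f i a) =O[nhds a] fun x => x - a :=
    Asymptotics.isBigO_pi.2 fun i => (hf i).isBigO_sub
  obtain ⟨L, hL0, hL⟩ := hO.exists_pos
  obtain ⟨δ, hδ0, hδ⟩ := Metric.eventually_nhds_iff.1 hL.bound
  refine ⟨δ, hδ0, L, hL0, fun x hx i => ?_⟩
  exact (norm_le_pi_norm (fun i => f i x - f i a) i).trans (hδ (by rwa [dist_eq_norm]))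

/-- the Lagrange multiplier estimate is unique and `O(γ)`-close to `λ̄`
for reference points in `B_γ(x̄)`. -/
theorem stmt11 {n k : ℕ} (φ : Fin k → EuclideanSpace ℝ (Fin n) → ℝ)
    (hC2 : ∀ i, ContDiff ℝ 2 (φ i))
    (xbar : EuclideanSpace ℝ (Fin n))
    (hindep : LinearIndependent ℝ
      (fun i => ((gradient (φ i) xbar, 1) : EuclideanSpace ℝ (Fin n) × ℝ)))
    (lambar : EuclideanSpace ℝ (Fin k)) (hlam1 : ∑ i, lambar i = 1)
    (hstat : ∑ i, lambar i • gradient (φ i) xbar = 0) :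
    ∃ γ₀ > (0:ℝ), ∃ C > (0:ℝ), ∀ γ : ℝ, 0 < γ → γ ≤ γ₀ →
      ∀ x : Fin k → EuclideanSpace ℝ (Fin n), (∀ i, ‖x i - xbar‖ ≤ γ) →
      ∃ lam : EuclideanSpace ℝ (Fin k),
        (∑ i, lam i = 1 ∧
          ∀ μ : EuclideanSpace ℝ (Fin k), ∑ i, μ i = 1 →
            ‖∑ i, lam i • gradient (φ i) (x i)‖ ≤ ‖∑ i, μ i • gradient (φ i) (x i)‖) ∧
        (∀ lam' : EuclideanSpace ℝ (Fin k),
          (∑ i, lam' i = 1 ∧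
            ∀ μ : EuclideanSpace ℝ (Fin k), ∑ i, μ i = 1 →
              ‖∑ i, lam' i • gradient (φ i) (x i)‖ ≤ ‖∑ i, μ i • gradient (φ i) (x i)‖) →
          lam' = lam) ∧
        ‖lam - lambar‖ ≤ C * γ := by
  obtain ⟨K, hK0, hK⟩ := exists_norm_le_mul_norm_euclideanCombination _ hindep
  obtain ⟨δ, hδ0, L, hL0, hL⟩ := exists_forall_norm_sub_le_of_differentiableAt
    fun i => (hC2 i).differentiable_gradient xbar
  refine ⟨min (δ / 2) (1 / (2 * (K * (k * L) + 1))), by positivity,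
    2 * K * (k * L) * ‖lambar‖ + 1, by positivity, fun γ hγ0 hγ x hx => ?_⟩
  have hγδ : γ < δ := (hγ.trans (min_le_left _ _)).trans_lt (half_lt_self hδ0)
  have hγK : K * (k * L) * γ ≤ 1 / 2 := by
    have h := hγ.trans (min_le_right _ _)
    rw [le_div_iff₀ (by positivity)] at h
    nlinarith
  set G := euclideanCombination fun i => gradient (φ i) (x i) with hG
  set G₀ := euclideanCombination fun i => gradient (φ i) xbar with hG₀
  have hpert (v : EuclideanSpace ℝ (Fin k)) : ‖G v - G₀ v‖ ≤ k * (L * γ) * ‖v‖ := by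
    have hsub : G v - G₀ v =
        euclideanCombination (fun i => gradient (φ i) (x i) - gradient (φ i) xbar) v := by
      simp only [hG, hG₀, euclideanCombination_apply, smul_sub, Finset.sum_sub_distrib]
    rw [hsub]
    refine norm_euclideanCombination_le _ (fun i => ?_) v
    exact (hL (x i) ((hx i).trans_lt hγδ) i).trans (by gcongr; exact hx i)
  let V : Submodule ℝ (EuclideanSpace ℝ (Fin k)) :=
    LinearMap.ker (euclideanCombination fun _ : Fin k => (1 : ℝ))
  have hV (v : EuclideanSpace ℝ (Fin k)) : v ∈ V ↔ ∑ i, v i = 0 := by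
    simp [V, euclideanCombination_apply]
  have hVsub {μ ν : EuclideanSpace ℝ (Fin k)} (hν : ∑ i, ν i = 1) :
      μ - ν ∈ V ↔ ∑ i, μ i = 1 := by
    simp [hV, Finset.sum_sub_distrib, hν, sub_eq_zero]
  have hGV : ∀ v ∈ V, ‖v‖ ≤ 2 * K * ‖G v‖ := fun v hv => by
    have h₀ : ‖G₀ v‖ ≤ ‖G v‖ + k * (L * γ) * ‖v‖ := by
      have h := norm_sub_norm_le (G₀ v) (G v)
      rw [norm_sub_rev] at h
      linarith [hpert v]
    have h₁ := (hK v ((hV v).1 hv)).trans (mul_le_mul_of_nonneg_left h₀ hK0.le)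
    have h₂ := mul_le_mul_of_nonneg_right hγK (norm_nonneg v)
    linarith
  obtain ⟨lam, hlamV, horth, hdist⟩ :=
    exists_sub_mem_forall_inner_map_eq_zero G V (by positivity) hGV lambar
  have hlam : ∑ i, lam i = 1 := (hVsub hlam1).1 hlamV
  have hpyth {μ : EuclideanSpace ℝ (Fin k)} (hμ : ∑ i, μ i = 1) :
      ‖G μ‖ * ‖G μ‖ = ‖G lam‖ * ‖G lam‖ + ‖G (μ - lam)‖ * ‖G (μ - lam)‖ := by
    rw [← norm_add_sq_eq_norm_sq_add_norm_sq_real (horth _ ((hVsub hlam).2 hμ)), ← map_add,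
      add_sub_cancel]
  simp only [← euclideanCombination_apply, ← hG]
  refine ⟨lam, ⟨hlam, fun μ hμ => ?_⟩, fun lam' ⟨hlam', hmin⟩ => ?_, hdist.trans ?_⟩
  · refine le_of_sq_le_sq ?_ (norm_nonneg _)
    nlinarith [hpyth hμ, mul_self_nonneg ‖G (μ - lam)‖]
  · have h := mul_self_le_mul_self (norm_nonneg _) (hmin lam hlam)
    have hzero : ‖G (lam' - lam)‖ = 0 := by
      rw [← mul_self_eq_zero]
      linarith [hpyth hlam', mul_self_nonneg ‖G (lam' - lam)‖]
    have hle := hGV _ ((hVsub hlam).2 hlam')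
    rw [hzero, mul_zero] at hle
    exact sub_eq_zero.1 (norm_le_zero_iff.1 hle)
  · have h := hpert lambar
    have hzero : G₀ lambar = 0 := by rw [hG₀, euclideanCombination_apply, hstat]
    rw [hzero, sub_zero] at h
    have h' := mul_le_mul_of_nonneg_left h (by positivity : 0 ≤ 2 * K)
    linarith
end

section
/- Suppose 0 ∈ conv{∇f_i(x̄) : i = 1, …, k} and, for every index j, 0 ∉ conv{∇f_i(x̄) : i ≠ j}. Then there exists ε > 0 such that for every full bundle S in B_ε(x̄) and every point x̂ ∈ D ∩ B_ε(x̄) with x̂ ∉ S, there is a unique s* ∈ S minimizing the function s ↦ Θ((S \ {s}) ∪ {x̂}) over s ∈ S; moreover, if x̂ ∈ D_i then s* is the unique element of S lying in D_i, and the new set (S \ {s*}) ∪ {x̂} is again a full bundle in B_ε(x̄). -/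
/-- The activity region of index `i` for the family `φ`. -/
def activityRegion {n k : ℕ} (φ : Fin k → EuclideanSpace ℝ (Fin n) → ℝ) (i : Fin k) :
    Set (EuclideanSpace ℝ (Fin n)) :=
  {x | ∀ j, j ≠ i → φ j x < φ i x}

/-- The optimality measure `Θ(A) = min{|g| : g ∈ conv ∇f(A)}` of a set `A`. -/
noncomputable def optMeasure {n : ℕ} (f : EuclideanSpace ℝ (Fin n) → ℝ)
    (A : Set (EuclideanSpace ℝ (Fin n))) : ℝ :=
  sInf {t : ℝ | ∃ g ∈ convexHull ℝ (gradient f '' A), t = ‖g‖}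

open Filter Topology Pointwise

theorem isOpen_activityRegion {n k : ℕ} {φ : Fin k → EuclideanSpace ℝ (Fin n) → ℝ}
    (hφ : ∀ i, Continuous (φ i)) (i : Fin k) : IsOpen (activityRegion φ i) := by
  simp only [activityRegion, Set.ofPred_forall]
  exact isOpen_iInter_of_finite fun j => isOpen_iInter_of_finite fun _ =>
    isOpen_lt (hφ j) (hφ i)

theorem activityRegion_index_unique {n k : ℕ} {φ : Fin k → EuclideanSpace ℝ (Fin n) → ℝ}
    {i j : Fin k} {x : EuclideanSpace ℝ (Fin n)} (hi : x ∈ activityRegion φ i)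
    (hj : x ∈ activityRegion φ j) : i = j := by
  by_contra h
  exact lt_asymm (hi j (Ne.symm h)) (hj i h)

/-- On an activity region the maximum function has the gradient of the active function. -/
theorem gradient_eq_of_mem_activityRegion {n k : ℕ}
    {φ : Fin k → EuclideanSpace ℝ (Fin n) → ℝ} (hφ : ∀ i, Continuous (φ i))
    {f : EuclideanSpace ℝ (Fin n) → ℝ} (hf : ∀ x, f x = ⨆ i, φ i x) {i : Fin k}
    {x : EuclideanSpace ℝ (Fin n)} (hx : x ∈ activityRegion φ i) :
    gradient f x = gradient (φ i) x := by
  have heq : f =ᶠ[𝓝 x] φ i := by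
    filter_upwards [(isOpen_activityRegion hφ i).mem_nhds hx] with y hy
    have : Nonempty (Fin k) := ⟨i⟩
    rw [hf]
    refine le_antisymm (ciSup_le fun j => ?_)
      (le_ciSup (Set.finite_range fun j => φ j y).bddAbove i)
    by_cases hji : j = i
    · rw [hji]
    · exact (hy j hji).le
  rw [gradient, gradient, heq.fderiv_eq]

theorem continuous_gradient_of_contDiff_two {n : ℕ} {g : EuclideanSpace ℝ (Fin n) → ℝ}
    (hg : ContDiff ℝ 2 g) : Continuous (gradient g) :=
  (LinearIsometryEquiv.continuous _).comp (hg.continuous_fderiv (by norm_num))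

theorem exists_mem_convexHull_norm_sub_le {E : Type*} [SeminormedAddCommGroup E]
    [NormedSpace ℝ E] {A B : Set E} {c : ℝ} (h : ∀ a ∈ A, ∃ b ∈ B, ‖a - b‖ ≤ c) {a : E}
    (ha : a ∈ convexHull ℝ A) : ∃ b ∈ convexHull ℝ B, ‖a - b‖ ≤ c := by
  have hsub : convexHull ℝ A ⊆ convexHull ℝ B + Metric.closedBall (0 : E) c := by
    refine convexHull_min (fun a ha => ?_)
      ((convex_convexHull ℝ B).add (convex_closedBall (0 : E) c))
    obtain ⟨b, hb, hab⟩ := h a ha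
    exact ⟨b, subset_convexHull ℝ B hb, a - b, by simpa using hab, by simp⟩
  obtain ⟨b, hb, e, he, rfl⟩ := hsub ha
  exact ⟨b, hb, by simpa using he⟩

theorem exists_pos_forall_le_norm_convexHull {E : Type*} [NormedAddCommGroup E]
    [NormedSpace ℝ E] {ι : Type*} [Finite ι] {B : ι → Set E} (hfin : ∀ j, (B j).Finite)
    (h0 : ∀ j, (0 : E) ∉ convexHull ℝ (B j)) :
    ∃ c > (0 : ℝ), ∀ j, ∀ g ∈ convexHull ℝ (B j), c ≤ ‖g‖ := by
  have hev : ∀ᶠ c in 𝓝[>] (0 : ℝ), ∀ j, ∀ g ∈ convexHull ℝ (B j), c ≤ ‖g‖ := by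
    refine eventually_all.2 fun j => ?_
    have hmem := (hfin j).isClosed_convexHull ℝ |>.isOpen_compl.mem_nhds (h0 j)
    obtain ⟨r, hr, hball⟩ := Metric.mem_nhds_iff.1 hmem
    filter_upwards [Ioo_mem_nhdsGT hr] with c hc g hg
    by_contra! hlt
    exact hball (by simpa using hlt.trans hc.2) hg
  obtain ⟨c, hc, hpos⟩ := (hev.and self_mem_nhdsWithin).exists
  exact ⟨c, hpos, hc⟩

theorem optMeasure_le {n : ℕ} {f : EuclideanSpace ℝ (Fin n) → ℝ}
    {A : Set (EuclideanSpace ℝ (Fin n))} {g : EuclideanSpace ℝ (Fin n)}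
    (hg : g ∈ convexHull ℝ (gradient f '' A)) : optMeasure f A ≤ ‖g‖ := by
  refine csInf_le ⟨0, ?_⟩ ⟨g, hg, rfl⟩
  rintro _ ⟨g, -, rfl⟩
  exact norm_nonneg g

theorem le_optMeasure {n : ℕ} {f : EuclideanSpace ℝ (Fin n) → ℝ}
    {A : Set (EuclideanSpace ℝ (Fin n))} (hA : A.Nonempty) {c : ℝ}
    (h : ∀ g ∈ convexHull ℝ (gradient f '' A), c ≤ ‖g‖) : c ≤ optMeasure f A := by
  obtain ⟨g, hg⟩ := (hA.image (gradient f)).convexHull (𝕜 := ℝ)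
  refine le_csInf ⟨‖g‖, g, hg, rfl⟩ ?_
  rintro _ ⟨g, hg, rfl⟩
  exact h g hg

/-- Replacing the value of an injective family at one index replaces that point of its range. -/
theorem range_update_of_injective {ι α : Type*} [DecidableEq ι] {x : ι → α}
    (hx : Function.Injective x) (i : ι) (y : α) :
    (Set.range x \ {x i}) ∪ {y} = Set.range (Function.update x i y) := by
  ext z
  constructor
  · rintro (⟨⟨j, rfl⟩, hj⟩ | rfl)
    · exact ⟨j, Function.update_of_ne (fun h => hj (by rw [h]; rfl)) _ _⟩
    · exact ⟨i, Function.update_self ..⟩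
  · rintro ⟨j, rfl⟩
    by_cases hji : j = i
    · subst hji
      simp
    · rw [Function.update_of_ne hji]
      exact Or.inl ⟨⟨j, rfl⟩, fun h => hji (hx h)⟩

/-- near `x̄`, substituting a new reference point into a full bundle by
minimizing the optimality measure removes precisely the old point from the same
activity region and yields a new full bundle.  -/
theorem stmt13 {n k : ℕ} (φ : Fin k → EuclideanSpace ℝ (Fin n) → ℝ)
    (hC2 : ∀ i, ContDiff ℝ 2 (φ i))
    (f : EuclideanSpace ℝ (Fin n) → ℝ) (hf : ∀ x, f x = ⨆ i, φ i x)
    (xbar : EuclideanSpace ℝ (Fin n))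
    (h0 : (0 : EuclideanSpace ℝ (Fin n)) ∈
      convexHull ℝ (Set.range fun i => gradient (φ i) xbar))
    (h0' : ∀ j, (0 : EuclideanSpace ℝ (Fin n)) ∉
      convexHull ℝ {g | ∃ i, i ≠ j ∧ g = gradient (φ i) xbar}) :
    ∃ ε > (0:ℝ),
      ∀ x : Fin k → EuclideanSpace ℝ (Fin n),
        (∀ i, x i ∈ activityRegion φ i ∧ ‖x i - xbar‖ ≤ ε) →
      ∀ xhat : EuclideanSpace ℝ (Fin n),
        (∃ i, xhat ∈ activityRegion φ i) → ‖xhat - xbar‖ ≤ ε → xhat ∉ Set.range x →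
      ∀ i, xhat ∈ activityRegion φ i →
        -- x i minimizes s ↦ Θ((S \ {s}) ∪ {x̂}) over s ∈ S ...
        ((∀ s ∈ Set.range x,
            optMeasure f ((Set.range x \ {x i}) ∪ {xhat}) ≤
              optMeasure f ((Set.range x \ {s}) ∪ {xhat})) ∧
        -- ... and is the unique such minimizer,
        (∀ s ∈ Set.range x,
          (∀ s' ∈ Set.range x,
            optMeasure f ((Set.range x \ {s}) ∪ {xhat}) ≤
              optMeasure f ((Set.range x \ {s'}) ∪ {xhat})) → s = x i) ∧
        -- and the new set is again a full bundle in B_ε(x̄)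
        (∃ x' : Fin k → EuclideanSpace ℝ (Fin n),
          (∀ j, x' j ∈ activityRegion φ j ∧ ‖x' j - xbar‖ ≤ ε) ∧
          (Set.range x \ {x i}) ∪ {xhat} = Set.range x')) := by
  classical
  have hφ i : Continuous (φ i) := (hC2 i).continuous
  obtain ⟨c, hc, hcle⟩ := exists_pos_forall_le_norm_convexHull
    (B := fun j => {g | ∃ i, i ≠ j ∧ g = gradient (φ i) xbar})
    (fun j => (Set.finite_range fun i => gradient (φ i) xbar).subset
      (by rintro _ ⟨i, -, rfl⟩; exact ⟨i, rfl⟩)) h0'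
  obtain ⟨ε, hε, hclose⟩ : ∃ ε > (0 : ℝ), ∀ y, ‖y - xbar‖ ≤ ε → ∀ i,
      ‖gradient (φ i) y - gradient (φ i) xbar‖ ≤ c / 3 := by
    have hev : ∀ᶠ y in 𝓝 xbar, ∀ i, ‖gradient (φ i) y - gradient (φ i) xbar‖ ≤ c / 3 := by
      refine eventually_all.2 fun i => ?_
      have hcont := (continuous_gradient_of_contDiff_two (hC2 i)).tendsto xbar
      filter_upwards [hcont (Metric.closedBall_mem_nhds _ (by positivity : 0 < c / 3))] with y hy
      simpa [dist_eq_norm] using hy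
    obtain ⟨ε, hε, hsub⟩ := Metric.nhds_basis_closedBall.mem_iff.1 hev
    exact ⟨ε, hε, fun y hy => hsub (by simpa [dist_eq_norm] using hy)⟩
  refine ⟨ε, hε, fun x hx xhat _ hxhat _ i hi => ?_⟩
  have hinj : Function.Injective x := fun a b hab =>
    activityRegion_index_unique (hx a).1 (hab ▸ (hx b).1)
  have hupdate : ∀ j, Function.update x i xhat j ∈ activityRegion φ j ∧
      ‖Function.update x i xhat j - xbar‖ ≤ ε := by
    intro j
    by_cases hji : j = i
    · subst hji
      simpa using ⟨hi, hxhat⟩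
    · simpa [Function.update_of_ne hji] using hx j
  have hupper : optMeasure f ((Set.range x \ {x i}) ∪ {xhat}) ≤ c / 3 := by
    rw [range_update_of_injective hinj]
    obtain ⟨g, hg, hgc⟩ := exists_mem_convexHull_norm_sub_le
      (B := gradient f '' Set.range (Function.update x i xhat)) (c := c / 3)
      (by
        rintro _ ⟨j, rfl⟩
        refine ⟨_, ⟨_, ⟨j, rfl⟩, rfl⟩, ?_⟩
        rw [gradient_eq_of_mem_activityRegion hφ hf (hupdate j).1, norm_sub_rev]
        exact hclose _ (hupdate j).2 j) h0
    exact (optMeasure_le hg).trans (by simpa using hgc)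
  have hlower : ∀ j, j ≠ i →
      2 * c / 3 ≤ optMeasure f ((Set.range x \ {x j}) ∪ {xhat}) := by
    intro j hji
    refine le_optMeasure ⟨xhat, Or.inr rfl⟩ fun g hg => ?_
    obtain ⟨b, hb, hgb⟩ := exists_mem_convexHull_norm_sub_le
      (B := {g | ∃ l, l ≠ j ∧ g = gradient (φ l) xbar}) (c := c / 3)
      (by
        rintro _ ⟨y, ⟨⟨l, rfl⟩, hl⟩ | rfl, rfl⟩
        · refine ⟨_, ⟨l, fun h => hl (by rw [h]; rfl), rfl⟩, ?_⟩
          rw [gradient_eq_of_mem_activityRegion hφ hf (hx l).1]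
          exact hclose _ (hx l).2 l
        · refine ⟨_, ⟨i, hji.symm, rfl⟩, ?_⟩
          rw [gradient_eq_of_mem_activityRegion hφ hf hi]
          exact hclose _ hxhat i) hg
    have hcb := hcle j b hb
    have htri := norm_sub_norm_le b g
    rw [norm_sub_rev] at htri
    linarith
  refine ⟨?_, ?_, Function.update x i xhat, hupdate, range_update_of_injective hinj i xhat⟩
  · rintro _ ⟨j, rfl⟩
    by_cases hji : j = i
    · rw [hji]
    · linarith [hlower j hji]
  · rintro _ ⟨j, rfl⟩ hmin
    by_contra hne
    linarith [hlower j (fun h => hne (by rw [h])), hmin (x i) ⟨i, rfl⟩]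
end
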